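/- In the quadratic algebra B defined by a linear involution R of E⊗E, one has (X^p * Y^q) * (X^r * Y^s) = X^{p+r} * Y^{q+s} for all natural numbers p, q, r, s (equality of products of ℝ-submodules of B). (This is the paper's identity A^{(p,q)}A^{(r,s)} = A^{(p+r,q+s)}.) -/

import Mathlib

open scoped TensorProduct
open TensorAlgebra

noncomputable section

variable (E : Type*) [AddCommGroup E] [Module ℝ E]

/-- The linear map `E ⊗ E → T(E ⊕ E)` sending `u ⊗ v` to `ι(a u) * ι(b v)` for two
linear inclusions `a b : E → E ⊕ E`; e.g. `(y⊗x)(u⊗v) = y(u)⊗x(v)`. -/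
def pairMul (a b : E →ₗ[ℝ] E × E) :
    E ⊗[ℝ] E →ₗ[ℝ] TensorAlgebra ℝ (E × E) :=
  LinearMap.mul' ℝ (TensorAlgebra ℝ (E × E)) ∘ₗ
    TensorProduct.map (ι ℝ ∘ₗ a) (ι ℝ ∘ₗ b)

/-- The relations of the paper's bigraded algebra `A`: with `x, y : E → E ⊕ E` the two
canonical inclusions, `x(u)x(v) = (x⊗x)(R(u⊗v))`, `x(u)y(v) = (y⊗x)(R(u⊗v))`,
`y(u)x(v) = (x⊗y)(R(u⊗v))` and `y(u)y(v) = −(y⊗y)(R(u⊗v))`. -/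
def BRel (R : E ⊗[ℝ] E →ₗ[ℝ] E ⊗[ℝ] E) :
    TensorAlgebra ℝ (E × E) → TensorAlgebra ℝ (E × E) → Prop :=
  fun p q => ∃ u v : E,
    (p = ι ℝ (LinearMap.inl ℝ E E u) * ι ℝ (LinearMap.inl ℝ E E v) ∧
      q = pairMul E (LinearMap.inl ℝ E E) (LinearMap.inl ℝ E E) (R (u ⊗ₜ[ℝ] v))) ∨
    (p = ι ℝ (LinearMap.inl ℝ E E u) * ι ℝ (LinearMap.inr ℝ E E v) ∧
      q = pairMul E (LinearMap.inr ℝ E E) (LinearMap.inl ℝ E E) (R (u ⊗ₜ[ℝ] v))) ∨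
    (p = ι ℝ (LinearMap.inr ℝ E E u) * ι ℝ (LinearMap.inl ℝ E E v) ∧
      q = pairMul E (LinearMap.inl ℝ E E) (LinearMap.inr ℝ E E) (R (u ⊗ₜ[ℝ] v))) ∨
    (p = ι ℝ (LinearMap.inr ℝ E E u) * ι ℝ (LinearMap.inr ℝ E E v) ∧
      q = - pairMul E (LinearMap.inr ℝ E E) (LinearMap.inr ℝ E E) (R (u ⊗ₜ[ℝ] v)))

/-- An algebra map sends `(a⊗b)(t)` into the product of the images of `a` and `b`. -/
theorem map_pairMul_mem_mul {A : Type*} [Semiring A] [Algebra ℝ A]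
    (f : TensorAlgebra ℝ (E × E) →ₐ[ℝ] A) (a b : E →ₗ[ℝ] E × E) (t : E ⊗[ℝ] E) :
    f (pairMul E a b t) ∈
      LinearMap.range (f.toLinearMap ∘ₗ ι ℝ ∘ₗ a) *
        LinearMap.range (f.toLinearMap ∘ₗ ι ℝ ∘ₗ b) := by
  induction t with
  | zero => simp
  | tmul u v =>
    simpa [pairMul] using Submodule.mul_mem_mul
      (LinearMap.mem_range_self (f.toLinearMap ∘ₗ ι ℝ ∘ₗ a) u)
      (LinearMap.mem_range_self (f.toLinearMap ∘ₗ ι ℝ ∘ₗ b) v)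
  | add s t hs ht => simpa using add_mem hs ht

/-- The degree-one components `X` and `Y` of the quadratic algebra commute as submodules. -/
theorem commute_range_inl_range_inr (R : E ⊗[ℝ] E →ₗ[ℝ] E ⊗[ℝ] E) :
    Commute
      (LinearMap.range ((RingQuot.mkAlgHom ℝ (BRel E R)).toLinearMap ∘ₗ
        ι ℝ ∘ₗ LinearMap.inl ℝ E E))
      (LinearMap.range ((RingQuot.mkAlgHom ℝ (BRel E R)).toLinearMap ∘ₗ
        ι ℝ ∘ₗ LinearMap.inr ℝ E E)) := by
  apply le_antisymm <;> rw [Submodule.mul_le] <;> rintro _ ⟨u, rfl⟩ _ ⟨v, rfl⟩ <;>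
    simp only [LinearMap.comp_apply, AlgHom.toLinearMap_apply] <;> rw [← map_mul]
  · rw [RingQuot.mkAlgHom_rel ℝ (show BRel E R _ _ from ⟨u, v, .inr (.inl ⟨rfl, rfl⟩)⟩)]
    exact map_pairMul_mem_mul E _ _ _ _
  · rw [RingQuot.mkAlgHom_rel ℝ (show BRel E R _ _ from ⟨u, v, .inr (.inr (.inl ⟨rfl, rfl⟩))⟩)]
    exact map_pairMul_mem_mul E _ _ _ _

/-- In the quadratic algebra `B` defined by a linear involution `R` of
`E ⊗ E`, one has `(X^p * Y^q) * (X^r * Y^s) = X^{p+r} * Y^{q+s}` (the paper's identity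
`A^{(p,q)}A^{(r,s)} = A^{(p+r,q+s)}`). -/
theorem submodule_bigraded_mul
    [FiniteDimensional ℝ E]
    (R : E ⊗[ℝ] E →ₗ[ℝ] E ⊗[ℝ] E) (hR : R ∘ₗ R = LinearMap.id)
    (X Y : Submodule ℝ (RingQuot (BRel E R)))
    (hX : X = LinearMap.range ((RingQuot.mkAlgHom ℝ (BRel E R)).toLinearMap ∘ₗ
      ι ℝ ∘ₗ LinearMap.inl ℝ E E))
    (hY : Y = LinearMap.range ((RingQuot.mkAlgHom ℝ (BRel E R)).toLinearMap ∘ₗ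
      ι ℝ ∘ₗ LinearMap.inr ℝ E E)) :
    ∀ p q r s : ℕ, (X ^ p * Y ^ q) * (X ^ r * Y ^ s) = X ^ (p + r) * Y ^ (q + s) := by
  intro p q r s
  have h : Commute X Y := by
    rw [hX, hY]
    exact commute_range_inl_range_inr E R
  rw [(h.symm.pow_pow q r).mul_mul_mul_comm, ← pow_add, ← pow_add]
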